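/- Assume all influences are non-negative. Let p_t be a price and O' ⊆ {1,…,n} a set of agents such that [q̲(p)]_i = 1 for every i ∈ O' and every price p < p_t. Consider the subproblem on the agents V' = {1,…,n} ∖ O' with influence matrix T restricted to V' × V' and valuation intervals [a_i', b_i'] = [a_i + Σ_{j∈O'} T_{j,i}, b_i + Σ_{j∈O'} T_{j,i}] for i ∈ V', and let q̲'(p) denote its pessimistic equilibrium. Then for every p < p_t, the pessimistic equilibrium of the original problem satisfies [q̲(p)]_i = [q̲'(p)]_i for every i ∈ V' and [q̲(p)]_i = 1 for every i ∈ O'. -/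

import Mathlib

open Filter Topology

/-- med{0,1,x} = max(0, min(1, x)). -/
noncomputable def med (x : ℝ) : ℝ := max 0 (min 1 x)

/-- The transfer function `f_p` of a pricing instance (over an arbitrary finite
set of agents). -/
noncomputable def transfer {ι : Type*} [Fintype ι] (a b : ι → ℝ)
    (T : Matrix ι ι ℝ) (p : ℝ) (q : ι → ℝ) : ι → ℝ :=
  fun i => med ((b i - p + ∑ j, T j i * q j) / (b i - a i))

lemma med_monotone : Monotone med := fun _ _ h =>
  max_le_max le_rfl (min_le_min le_rfl h)

lemma continuous_med : Continuous med := by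
  unfold med
  fun_prop

lemma med_nonneg (x : ℝ) : 0 ≤ med x := le_max_left _ _

lemma med_le_one (x : ℝ) : med x ≤ 1 := max_le zero_le_one (min_le_left _ _)

section Transfer

variable {ι : Type*} [Fintype ι] {a b : ι → ℝ} {T : Matrix ι ι ℝ} {p : ℝ}

lemma transfer_monotone (hab : ∀ i, a i < b i) (hT : ∀ i j, 0 ≤ T j i) :
    Monotone (transfer a b T p) := by
  intro q r hqr i
  refine med_monotone (div_le_div_of_nonneg_right ?_ (sub_pos.2 (hab i)).le)
  gcongr with j
  · exact hT i j
  · exact hqr j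

lemma continuous_transfer : Continuous (transfer a b T p) := by
  refine continuous_pi fun i => continuous_med.comp ?_
  fun_prop

/-- A limit of iterates of the transfer function is an equilibrium. -/
lemma transfer_eq_of_tendsto_iterate {q₀ q : ι → ℝ}
    (h : ∀ i, Tendsto (fun m : ℕ => (transfer a b T p)^[m] q₀ i) atTop (𝓝 (q i))) :
    transfer a b T p q = q :=
  isFixedPt_of_tendsto_iterate (tendsto_pi_nhds.2 h) continuous_transfer.continuousAt

/-- The iterates from `0` stay below every equilibrium. -/
lemma iterate_transfer_zero_le (hab : ∀ i, a i < b i) (hT : ∀ i j, 0 ≤ T j i) {q : ι → ℝ}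
    (hq : transfer a b T p q = q) (m : ℕ) :
    (transfer a b T p)^[m] (fun _ => 0) ≤ q := by
  have h0 : (fun _ => 0) ≤ q := fun i => by
    rw [← hq]
    exact med_nonneg _
  calc (transfer a b T p)^[m] (fun _ => 0) ≤ (transfer a b T p)^[m] q :=
        (transfer_monotone hab hT).iterate m h0
    _ = q := Function.iterate_fixed hq m

/-- On profiles equal to `1` on `O`, the transfer function agrees off `O` with that of the
subproblem with shifted valuation intervals. -/
lemma transfer_subproblem [DecidableEq ι] {O : Finset ι} {a' b' : {i // i ∈ Oᶜ} → ℝ}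
    {T' : Matrix {i // i ∈ Oᶜ} {i // i ∈ Oᶜ} ℝ}
    (ha' : ∀ i, a' i = a i.1 + ∑ j ∈ O, T j i.1)
    (hb' : ∀ i, b' i = b i.1 + ∑ j ∈ O, T j i.1)
    (hT' : ∀ i j, T' i j = T i.1 j.1) {q : ι → ℝ} (hq : ∀ i ∈ O, q i = 1)
    (i : {i // i ∈ Oᶜ}) :
    transfer a' b' T' p (fun j => q j.1) i = transfer a b T p q i.1 := by
  have hsum : ∑ j, T j i.1 * q j = ∑ j ∈ O, T j i.1 + ∑ j, T' j i * q j.1 := by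
    rw [← Finset.sum_add_sum_compl O]
    congr 1
    · exact Finset.sum_congr rfl fun j hj => by rw [hq j hj, mul_one]
    · simp only [hT']
      exact (Finset.sum_coe_sort Oᶜ fun j => T j i.1 * q j).symm
  unfold transfer
  rw [hsum, ha', hb']
  congr 2 <;> ring

end Transfer

/-- recursion on the subproblem: with non-negative influences,
if `O'` is a set of agents whose pessimistic-equilibrium probability is `1`
at every price `p < p_t`, then for every `p < p_t` the pessimistic equilibrium
of the original problem restricted to `V' = [n] ∖ O'` coincides with the
pessimistic equilibrium of the subproblem on `V'` with shifted valuation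
intervals `[aᵢ + Σ_{j∈O'} T_{j,i}, bᵢ + Σ_{j∈O'} T_{j,i}]`, and equals `1`
on `O'`. -/
theorem pessimistic_of_subproblem (n : ℕ) (a b : Fin n → ℝ)
    (T : Matrix (Fin n) (Fin n) ℝ)
    (ha : ∀ i, 0 ≤ a i) (hab : ∀ i, a i < b i)
    (hTdiag : ∀ i, T i i = 0) (hTnn : ∀ i j, 0 ≤ T j i)
    (pt : ℝ) (O' : Finset (Fin n))
    -- pessimistic equilibrium of the original problem at every price
    (qlow : ℝ → Fin n → ℝ)
    (hqlow : ∀ p i, Tendsto (fun m : ℕ => (transfer a b T p)^[m] (fun _ => 0) i)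
      atTop (𝓝 (qlow p i)))
    -- the agents of O' buy with probability 1 at every price below p_t
    (hO' : ∀ p < pt, ∀ i ∈ O', qlow p i = 1)
    -- the subproblem on V' = [n] \ O'
    (a' b' : {i // i ∈ O'ᶜ} → ℝ)
    (ha' : ∀ i, a' i = a i.1 + ∑ j ∈ O', T j i.1)
    (hb' : ∀ i, b' i = b i.1 + ∑ j ∈ O', T j i.1)
    (T' : Matrix {i // i ∈ O'ᶜ} {i // i ∈ O'ᶜ} ℝ)
    (hT' : ∀ i j, T' i j = T i.1 j.1)
    -- pessimistic equilibrium of the subproblem at every price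
    (qlow' : ℝ → {i // i ∈ O'ᶜ} → ℝ)
    (hqlow' : ∀ p i,
      Tendsto (fun m : ℕ => (transfer a' b' T' p)^[m] (fun _ => 0) i)
        atTop (𝓝 (qlow' p i))) :
    ∀ p < pt, (∀ i : {i // i ∈ O'ᶜ}, qlow p i.1 = qlow' p i) ∧
      (∀ i ∈ O', qlow p i = 1) := by
  intro p hp
  refine ⟨fun i => le_antisymm ?_ ?_, hO' p hp⟩
  · let extend : ({i // i ∈ O'ᶜ} → ℝ) → Fin n → ℝ :=
      fun r k => if h : k ∈ O'ᶜ then r ⟨k, h⟩ else 1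
    have extend_one : ∀ r, ∀ k ∈ O', extend r k = 1 := fun r k hk => by simp [extend, hk]
    have extend_val : ∀ r, (fun k : {i // i ∈ O'ᶜ} => extend r k.1) = r := fun r =>
      funext fun k => dif_pos k.2
    have iterate_le : ∀ m : ℕ, (transfer a b T p)^[m] (fun _ => 0) ≤
        extend ((transfer a' b' T' p)^[m] (fun _ => 0)) := by
      intro m
      induction m with
      | zero =>
        intro k
        by_cases hk : k ∈ O' <;> simp [extend, hk]
      | succ m ih =>
        intro k
        rw [Function.iterate_succ_apply', Function.iterate_succ_apply']
        by_cases hk : k ∈ O'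
        · rw [extend_one _ k hk]
          exact med_le_one _
        · have hk' : k ∈ O'ᶜ := Finset.mem_compl.2 hk
          have key := transfer_subproblem (p := p) ha' hb' hT'
            (extend_one ((transfer a' b' T' p)^[m] (fun _ => 0))) ⟨k, hk'⟩
          rw [extend_val] at key
          refine (transfer_monotone hab hTnn ih k).trans ?_
          rw [← key]
          exact (congrFun (extend_val _) ⟨k, hk'⟩).ge
    refine le_of_tendsto_of_tendsto' (hqlow p i.1) (hqlow' p i) fun m => ?_
    exact (iterate_le m i.1).trans (congrFun (extend_val _) i).le
  · have hfix : transfer a' b' T' p (fun j => qlow p j.1) = fun j => qlow p j.1 := by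
      funext j
      rw [transfer_subproblem ha' hb' hT' (hO' p hp),
        transfer_eq_of_tendsto_iterate (hqlow p)]
    have hab' : ∀ j, a' j < b' j := fun j => by
      rw [ha', hb']
      exact add_lt_add_left (hab j.1) _
    have hTnn' : ∀ j k, 0 ≤ T' k j := fun j k => by
      rw [hT']
      exact hTnn _ _
    exact le_of_tendsto' (hqlow' p i) fun m => iterate_transfer_zero_le hab' hTnn' hfix m i
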